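/- Let W be a real symmetric n×n matrix and let X be feasible for the clustering SDP (X symmetric positive semidefinite, Xe ≤ e entrywise, tr(X) = k, X entrywise nonnegative). Suppose there exist μ ∈ ℝ, an entrywise nonnegative vector λ ∈ ℝⁿ, an entrywise nonnegative matrix Ξ ∈ ℝ^{n×n}, and a symmetric positive semidefinite matrix S ∈ ℝ^{n×n} such that −W + λeᵀ + eλᵀ − Ξ + μI = S, λᵀ(Xe − e) = 0, tr(XΞ) = 0, and tr(XS) = 0. Then X is optimal for the clustering SDP; that is, tr(WX) ≥ tr(WY) for every feasible Y. -/

import Mathlib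

open Matrix Finset

noncomputable section

/-- Feasibility for the clustering SDP: `X` symmetric PSD, entrywise nonnegative,
row sums at most 1 (`Xe ≤ e`), and trace equal to `k`. -/
def SDPFeasible (n k : ℕ) (X : Matrix (Fin n) (Fin n) ℝ) : Prop :=
  X.PosSemidef ∧ (∀ i j, 0 ≤ X i j) ∧ (∀ i, ∑ j, X i j ≤ 1) ∧ X.trace = (k : ℝ)

open scoped MatrixOrder in
/-- The trace of a product of two real positive semidefinite matrices is nonnegative. -/
lemma Matrix.PosSemidef.trace_mul_nonneg_real {ι : Type*} [Fintype ι]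
    {A B : Matrix ι ι ℝ} (hA : A.PosSemidef) (hB : B.PosSemidef) : 0 ≤ (A * B).trace := by
  classical
  obtain ⟨C, rfl⟩ := CStarAlgebra.nonneg_iff_eq_star_mul_self.mp hB.nonneg
  rw [Matrix.star_eq_conjTranspose, ← Matrix.mul_assoc, Matrix.trace_mul_comm, ← Matrix.mul_assoc]
  exact (hA.mul_mul_conjTranspose_same C).trace_nonneg

/-- The trace of a product of two entrywise nonnegative matrices is nonnegative. -/
lemma Matrix.trace_mul_nonneg_of_entries {ι : Type*} [Fintype ι] {A B : Matrix ι ι ℝ}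
    (hA : ∀ i j, 0 ≤ A i j) (hB : ∀ i j, 0 ≤ B i j) : 0 ≤ (A * B).trace :=
  Finset.sum_nonneg fun i _ => Finset.sum_nonneg fun j _ => mul_nonneg (hA i j) (hB j i)

/-- For symmetric `Z`, `tr ((λeᵀ + eλᵀ) Z) = 2 λᵀ (Z e)`. -/
lemma Matrix.trace_of_add_mul {ι : Type*} [Fintype ι] (v : ι → ℝ) {Z : Matrix ι ι ℝ}
    (hZ : Z.IsSymm) :
    (Matrix.of (fun i j => v i + v j) * Z).trace = 2 * ∑ i, v i * ∑ j, Z i j := by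
  have h : (Matrix.of (fun i j => v i + v j) * Z).trace
      = ∑ i, ∑ j, v i * Z i j + ∑ i, ∑ j, v j * Z j i := by
    simp only [Matrix.trace, Matrix.diag_apply, Matrix.mul_apply, Matrix.of_apply,
      ← Finset.sum_add_distrib]
    refine Finset.sum_congr rfl fun i _ => Finset.sum_congr rfl fun j _ => ?_
    rw [hZ.apply i j]
    ring
  rw [h, Finset.sum_comm (f := fun i j => v j * Z j i)]
  simp only [← Finset.mul_sum, two_mul]

/-- KKT-type sufficient condition for optimality in the clustering SDP. -/
theorem kkt_sufficiency (n k : ℕ) (W : Matrix (Fin n) (Fin n) ℝ) (hW : W.IsSymm)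
    (X : Matrix (Fin n) (Fin n) ℝ) (hX : SDPFeasible n k X)
    (μ : ℝ) (lam : Fin n → ℝ) (Ξ S : Matrix (Fin n) (Fin n) ℝ)
    (hlam : ∀ i, 0 ≤ lam i) (hΞ : ∀ i j, 0 ≤ Ξ i j) (hS : S.PosSemidef)
    (hstat : -W + Matrix.of (fun i j => lam i + lam j) - Ξ
        + μ • (1 : Matrix (Fin n) (Fin n) ℝ) = S)
    (hcs1 : ∑ i, lam i * ((∑ j, X i j) - 1) = 0)
    (hcs2 : (X * Ξ).trace = 0)
    (hcs3 : (X * S).trace = 0) :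
    ∀ Y : Matrix (Fin n) (Fin n) ℝ, SDPFeasible n k Y → (W * Y).trace ≤ (W * X).trace := by
  have lagrangian : ∀ Z : Matrix (Fin n) (Fin n) ℝ, SDPFeasible n k Z →
      (W * Z).trace = 2 * ∑ i, lam i * ∑ j, Z i j - (Ξ * Z).trace + μ * k - (S * Z).trace := by
    rintro Z ⟨hZ, -, -, htr⟩
    have hsymm : Z.IsSymm := by simpa using hZ.isHermitian
    rw [← hstat, ← Matrix.trace_of_add_mul lam hsymm, ← htr]
    simp only [Matrix.add_mul, Matrix.sub_mul, Matrix.neg_mul, Matrix.smul_mul, Matrix.one_mul,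
      Matrix.trace_add, Matrix.trace_sub, Matrix.trace_neg, Matrix.trace_smul, smul_eq_mul]
    ring
  intro Y hY
  rw [lagrangian X hX, lagrangian Y hY, Matrix.trace_mul_comm Ξ X, Matrix.trace_mul_comm S X,
    hcs2, hcs3]
  have hΞY := Matrix.trace_mul_nonneg_of_entries hΞ hY.2.1
  have hSY := hS.trace_mul_nonneg_real hY.1
  have hY_row : ∑ i, lam i * ∑ j, Y i j ≤ ∑ i, lam i :=
    Finset.sum_le_sum fun i _ => mul_le_of_le_one_right (hlam i) (hY.2.2.1 i)
  have hX_row : ∑ i, lam i * ∑ j, X i j = ∑ i, lam i := by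
    simpa only [mul_sub, mul_one, Finset.sum_sub_distrib, sub_eq_zero] using hcs1
  linarith
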